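/- Let σ > 0. Suppose B : (0,∞)^m → (0,∞) is twice differentiable and increasing in each variable. For j = 1,…,m let L_j : ℝⁿ → ℝ^{n_j} be a linear map with L_jL_j* = I (an isometry onto ℝ^{n_j}), and let u_j : (0,∞) × ℝ^{n_j} → (0,∞) be smooth with ∂_t u_j ≥ σΔu_j pointwise. If B is Γ-concave with Γ_{j,k} = L_jL_k*, i.e. Σ_{j,k=1}^m ∂_{j,k}B ⟨Γ_{j,k} v_k, v_j⟩ ≤ 0 for all vectors v_j ∈ ℝ^{n_j}, then ũ(t,x) := B(u₁(t,L₁x),…,u_m(t,L_mx)) satisfies ∂_t ũ ≥ σΔũ pointwise on (0,∞) × ℝⁿ. -/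

import Mathlib

noncomputable section
open Real MeasureTheory Matrix Set

/-- Partial derivative of `f` in the `i`-th coordinate direction. -/
def pd {ι : Type*} [Fintype ι] [DecidableEq ι] (f : (ι → ℝ) → ℝ) (i : ι) (x : ι → ℝ) : ℝ :=
  fderiv ℝ f x (Pi.single i 1)

/-- Hessian matrix. -/
def hess' {ι : Type*} [Fintype ι] [DecidableEq ι] (f : (ι → ℝ) → ℝ) (x : ι → ℝ) :
    Matrix ι ι ℝ :=
  Matrix.of fun i j => pd (fun y => pd f j y) i x

/-- Spatial Laplacian. -/
def lap' {ι : Type*} [Fintype ι] [DecidableEq ι] (f : (ι → ℝ) → ℝ) (x : ι → ℝ) : ℝ :=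
  ∑ i, hess' f x i i

theorem ContinuousLinearMap.apply_eq_sum_single {κ : Type*} [Fintype κ] [DecidableEq κ]
    (A : (κ → ℝ) →L[ℝ] ℝ) (v : κ → ℝ) : A v = ∑ j, A (Pi.single j 1) * v j := by
  conv_lhs => rw [pi_eq_sum_univ' v]
  simp [map_sum, mul_comm]

theorem pd_mulVec {ι κ : Type*} [Fintype ι] [DecidableEq ι] (M : Matrix κ ι ℝ) (a : κ)
    (i : ι) (x : ι → ℝ) : pd (fun z => M.mulVec z a) i x = M a i := by
  have h : (fun z => M.mulVec z a) =
      (((LinearMap.proj a).comp M.mulVecLin).toContinuousLinearMap : (ι → ℝ) →L[ℝ] ℝ) :=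
    rfl
  rw [pd, h, ContinuousLinearMap.fderiv]
  simp

theorem contDiff_mulVec {ι κ : Type*} [Fintype ι] [Fintype κ] (M : Matrix κ ι ℝ) :
    ContDiff ℝ 2 fun z => M.mulVec z :=
  M.mulVecLin.toContinuousLinearMap.contDiff

section ChainRule

variable {ι κ : Type*} [Fintype ι] [DecidableEq ι] [Fintype κ] [DecidableEq κ]

theorem pd_comp {B : (κ → ℝ) → ℝ} {w : (ι → ℝ) → κ → ℝ} {y : ι → ℝ}
    (hB : DifferentiableAt ℝ B (w y)) (hw : DifferentiableAt ℝ w y) (i : ι) :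
    pd (fun z => B (w z)) i y = ∑ j, pd B j (w y) * pd (fun z => w z j) i y := by
  have h : fderiv ℝ (fun z => B (w z)) y = (fderiv ℝ B (w y)).comp (fderiv ℝ w y) :=
    fderiv_comp y hB hw
  rw [pd, h, ContinuousLinearMap.comp_apply, ContinuousLinearMap.apply_eq_sum_single]
  refine Finset.sum_congr rfl fun j _ => ?_
  rw [pd, pd, fderiv_apply hw j]
  rfl

theorem ContDiffAt.differentiableAt_pd {f : (ι → ℝ) → ℝ} {x : ι → ℝ}
    (hf : ContDiffAt ℝ 2 f x) (i : ι) :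
    DifferentiableAt ℝ (pd f i) x :=
  ((hf.fderiv_right (m := 1) (by norm_num)).differentiableAt (by norm_num)).clm_apply
    (differentiableAt_const _)

/-- Chain rule for the Laplacian of a composition. -/
theorem lap_comp {B : (κ → ℝ) → ℝ} {w : (ι → ℝ) → κ → ℝ} {P : Set (κ → ℝ)} (hP : IsOpen P)
    (hB : ContDiffOn ℝ 2 B P) (hw : ContDiff ℝ 2 w) (hmem : ∀ y, w y ∈ P) (x : ι → ℝ) :
    lap' (fun z => B (w z)) x =
      ∑ j, ∑ k, hess' B (w x) j k *
        ∑ i, pd (fun z => w z j) i x * pd (fun z => w z k) i x +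
      ∑ j, pd B j (w x) * lap' (fun z => w z j) x := by
  have hBat (y : ι → ℝ) : ContDiffAt ℝ 2 B (w y) := hB.contDiffAt (hP.mem_nhds (hmem y))
  have hwd : Differentiable ℝ w := hw.differentiable (by norm_num)
  have hwj (j : κ) : ContDiff ℝ 2 fun z => w z j := contDiff_pi.1 hw j
  have hfirst (i : ι) : pd (fun z => B (w z)) i =
      fun y => ∑ j, pd B j (w y) * pd (fun z => w z j) i y :=
    funext fun y => pd_comp ((hBat y).differentiableAt (by norm_num)) (hwd y) i
  have hsecond (i : ι) : hess' (fun z => B (w z)) x i i =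
      ∑ j, (∑ k, hess' B (w x) k j * (pd (fun z => w z k) i x * pd (fun z => w z j) i x) +
        pd B j (w x) * hess' (fun z => w z j) x i i) := by
    have hd1 (j : κ) : DifferentiableAt ℝ (fun y => pd B j (w y)) x :=
      ((hBat x).differentiableAt_pd j).comp x (hwd x)
    have hd2 (j : κ) : DifferentiableAt ℝ (pd (fun z => w z j) i) x :=
      (hwj j).contDiffAt.differentiableAt_pd i
    change pd (pd (fun z => B (w z)) i) i x = _
    rw [hfirst, pd, fderiv_fun_sum fun j _ => (hd1 j).fun_mul (hd2 j), _root_.sum_apply]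
    refine Finset.sum_congr rfl fun j _ => ?_
    have h1 : pd (fun y => pd B j (w y)) i x =
        ∑ k, hess' B (w x) k j * pd (fun z => w z k) i x :=
      pd_comp ((hBat x).differentiableAt_pd j) (hwd x) i
    have h2 : fderiv ℝ (pd (fun z => w z j) i) x (Pi.single i 1) =
      hess' (fun z => w z j) x i i := rfl
    rw [pd] at h1
    rw [fderiv_fun_mul (hd1 j) (hd2 j)]
    simp only [_root_.add_apply, _root_.smul_apply, smul_eq_mul, h1, h2]
    rw [add_comm, Finset.mul_sum]
    congr 1
    exact Finset.sum_congr rfl fun k _ => by ring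
  rw [lap', Finset.sum_congr rfl fun i _ => hsecond i, Finset.sum_comm]
  simp only [Finset.sum_add_distrib, lap', Finset.mul_sum]
  congr 1
  exact (Finset.sum_congr rfl fun j _ => Finset.sum_comm).trans Finset.sum_comm

theorem pd_comp_mulVec {g : (κ → ℝ) → ℝ} (hg : ContDiff ℝ 2 g) (M : Matrix κ ι ℝ) (i : ι)
    (x : ι → ℝ) :
    pd (fun z => g (M.mulVec z)) i x = Mᵀ.mulVec (fun a => pd g a (M.mulVec x)) i := by
  rw [pd_comp (w := fun z => M.mulVec z) (hg.differentiable (by norm_num) _)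
    ((contDiff_mulVec M).differentiable (by norm_num) _)]
  simp only [pd_mulVec]
  simp only [Matrix.mulVec, dotProduct, Matrix.transpose_apply, mul_comm]

/-- The Laplacian commutes with coisometries. -/
theorem lap_comp_mulVec {g : (κ → ℝ) → ℝ} (hg : ContDiff ℝ 2 g) (M : Matrix κ ι ℝ)
    (hM : M * Mᵀ = 1) (x : ι → ℝ) :
    lap' (fun z => g (M.mulVec z)) x = lap' g (M.mulVec x) := by
  have hlin (a : κ) : lap' (fun z => M.mulVec z a) x = 0 := by
    simp only [lap', hess', pd_mulVec, Matrix.of_apply]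
    simp [pd]
  have hrow (j k : κ) : ∑ i, M j i * M k i = if j = k then 1 else 0 := by
    rw [← Matrix.one_apply, ← hM, Matrix.mul_apply]
    rfl
  rw [lap_comp isOpen_univ hg.contDiffOn (contDiff_mulVec M) (fun _ => Set.mem_univ _)]
  simp only [hlin, pd_mulVec, hrow]
  simp [lap']

end ChainRule

theorem isOpen_setOf_forall_pos {ι : Type*} [Finite ι] : IsOpen {x : ι → ℝ | ∀ i, 0 < x i} := by
  simp only [Set.ofPred_forall]
  exact isOpen_iInter_of_finite fun i => isOpen_lt continuous_const (continuous_apply i)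

/-- If `B` is Γ-concave with `Γ_{j,k} = L_jL_k*` for isometries `L_j`, and the `u_j` are
supersolutions of `∂ₜu = σΔu`, then `ũ = B(u₁∘L₁,…,u_m∘L_m)` is a supersolution. -/
theorem gamma_concave_closure
    {n m : ℕ} (σ : ℝ) (hσ : 0 < σ)
    (B : (Fin m → ℝ) → ℝ)
    (hB_smooth : ContDiffOn ℝ 2 B {x | ∀ i, 0 < x i})
    (hB_pos : ∀ x, (∀ i, 0 < x i) → 0 < B x)
    (hB_mono : ∀ x, (∀ i, (0:ℝ) < x i) → ∀ j, 0 ≤ pd B j x)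
    (d : Fin m → ℕ)
    (L : ∀ j, Matrix (Fin (d j)) (Fin n) ℝ)
    (hL_isom : ∀ j, L j * (L j)ᵀ = 1)
    (hB_gamma : ∀ x : Fin m → ℝ, (∀ i, 0 < x i) →
      ∀ v : (j : Fin m) → (Fin (d j) → ℝ),
        ∑ j, ∑ k, hess' B x j k * (((L j * (L k)ᵀ).mulVec (v k)) ⬝ᵥ (v j)) ≤ 0)
    (u : ∀ j, ℝ → (Fin (d j) → ℝ) → ℝ)
    (hu_smooth : ∀ j, ContDiffOn ℝ (⊤ : ℕ∞) (Function.uncurry (u j)) (Set.Ioi (0:ℝ) ×ˢ Set.univ))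
    (hu_pos : ∀ j, ∀ t > (0:ℝ), ∀ x, 0 < u j t x)
    (hu_super : ∀ j, ∀ t > (0:ℝ), ∀ x,
      deriv (fun s => u j s x) t ≥ σ * lap' (u j t) x)
    (util : ℝ → (Fin n → ℝ) → ℝ)
    (hutil : util = fun t x => B (fun j => u j t ((L j).mulVec x))) :
    ∀ t > (0:ℝ), ∀ x, deriv (fun s => util s x) t ≥ σ * lap' (util t) x := by
  intro t ht x
  subst hutil
  have hwp (s : ℝ) (hs : 0 < s) (y : Fin n → ℝ) (j : Fin m) : 0 < u j s ((L j).mulVec y) :=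
    hu_pos j s hs _
  have hBd : DifferentiableAt ℝ B fun j => u j t ((L j).mulVec x) :=
    (hB_smooth.contDiffAt (isOpen_setOf_forall_pos.mem_nhds (hwp t ht x))).differentiableAt
      (by norm_num)
  have huat (j : Fin m) (y : Fin (d j) → ℝ) :
      ContDiffAt ℝ (⊤ : ℕ∞) (Function.uncurry (u j)) (t, y) :=
    (hu_smooth j).contDiffAt ((isOpen_Ioi.prod isOpen_univ).mem_nhds ⟨ht, Set.mem_univ _⟩)
  have hut (j : Fin m) (y : Fin (d j) → ℝ) : DifferentiableAt ℝ (fun s => u j s y) t :=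
    ((huat j y).differentiableAt (by simp)).comp (f := fun s : ℝ => (s, y)) t (by fun_prop)
  have hux (j : Fin m) : ContDiff ℝ 2 (u j t) := contDiff_iff_contDiffAt.2 fun y =>
    ((huat j y).of_le (WithTop.coe_le_coe.2 (le_top : (2 : ℕ∞) ≤ ⊤))).comp (f := fun z => (t, z)) y
      (contDiffAt_const.prodMk contDiffAt_id)
  have hw : ContDiff ℝ 2 fun z j => u j t ((L j).mulVec z) :=
    contDiff_pi.2 fun j => (hux j).comp (contDiff_mulVec (L j))
  have htime : deriv (fun s => B fun j => u j s ((L j).mulVec x)) t =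
      ∑ j, pd B j (fun j => u j t ((L j).mulVec x)) *
        deriv (fun s => u j s ((L j).mulVec x)) t := by
    have h := hBd.hasFDerivAt.comp_hasDerivAt t
      (hasDerivAt_pi.2 fun j => (hut j ((L j).mulVec x)).hasDerivAt)
    exact h.deriv.trans (ContinuousLinearMap.apply_eq_sum_single _ _)
  have hgamma := hB_gamma _ (hwp t ht x) fun j a => pd (u j t) a ((L j).mulVec x)
  have hgrad (j k : Fin m) : ∑ i, pd (fun z => u j t ((L j).mulVec z)) i x *
      pd (fun z => u k t ((L k).mulVec z)) i x =
      (L j * (L k)ᵀ).mulVec (fun a => pd (u k t) a ((L k).mulVec x)) ⬝ᵥ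
        fun a => pd (u j t) a ((L j).mulVec x) := by
    simp only [pd_comp_mulVec (hux _)]
    rw [← Matrix.mulVec_mulVec, dotProduct_comm, Matrix.dotProduct_mulVec,
      ← Matrix.mulVec_transpose]
    rfl
  have hlap := lap_comp isOpen_setOf_forall_pos hB_smooth hw (hwp t ht) x
  simp only [hgrad, lap_comp_mulVec (hux _) _ (hL_isom _)] at hlap
  change _ ≥ σ * lap' (fun z => B fun j => u j t ((L j).mulVec z)) x
  rw [htime, hlap, mul_add]
  have hsum : σ * ∑ j, pd B j (fun j => u j t ((L j).mulVec x)) *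
      lap' (u j t) ((L j).mulVec x) ≤
      ∑ j, pd B j (fun j => u j t ((L j).mulVec x)) *
        deriv (fun s => u j s ((L j).mulVec x)) t := by
    rw [Finset.mul_sum]
    refine Finset.sum_le_sum fun j _ => ?_
    rw [mul_left_comm]
    exact mul_le_mul_of_nonneg_left (hu_super j t ht _) (hB_mono _ (hwp t ht x) j)
  linarith [mul_nonpos_of_nonneg_of_nonpos hσ.le hgamma]
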